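/- DPPs are ℓ∞-independent with parameter 2: Let X be a determinantal point process on {1,…,m} with Hermitian correlation kernel K (eigenvalues in [0,1]). Then X is ℓ∞-independent with parameter d_inf = 2. In particular, for every e with K_{ee} > 0, Σ_{i ∈ supp(ρ_X)} |δ_{X,e}(i)| = (1 − K_{ee}) + ((K²)_{ee} − (K_{ee})²)/K_{ee} ≤ 2 − 2K_{ee}. -/

import Mathlib

open Matrix Finset
open scoped Classical ComplexOrder

/-- Principal submatrix of `A` indexed by the finite set `S`. -/
noncomputable def principalSub {α : Type*} [Fintype α] [DecidableEq α]
    (A : Matrix α α ℂ) (S : Finset α) : Matrix S S ℂ :=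
  A.submatrix (fun i => (i : α)) (fun i => (i : α))

/-- `μ` is the law of a determinantal point process with correlation kernel `K`. -/
def IsDPP {α : Type*} [Fintype α] [DecidableEq α]
    (μ : Finset α → ℝ) (K : Matrix α α ℂ) : Prop :=
  ∀ A : Finset α,
    ((∑ F ∈ Finset.univ.filter (fun F => A ⊆ F), μ F : ℝ) : ℂ) = (principalSub K A).det

/-- Intensity of a point process: `ρ_X(i) = Pr(i ∈ X)`. -/
noncomputable def intensity {α : Type*} [Fintype α] [DecidableEq α]
    (μ : Finset α → ℝ) (i : α) : ℝ :=
  ∑ F ∈ Finset.univ.filter (fun F => i ∈ F), μ F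

/-- Normalizing constant of the reduced process `X_{A1}^{A0}`. -/
noncomputable def redNorm {α : Type*} [Fintype α] [DecidableEq α]
    (μ : Finset α → ℝ) (A0 A1 : Finset α) : ℝ :=
  ∑ B ∈ Finset.univ.filter (fun B => Disjoint B (A0 ∪ A1)), μ (A1 ∪ B)

/-- The reduced process `X_{A1}^{A0}` obtained from `μ` by excluding `A0` and
including `A1`: its law on subsets `B` of the complement of `A0 ∪ A1` is
proportional to `μ (A1 ∪ B)`. -/
noncomputable def reduced {α : Type*} [Fintype α] [DecidableEq α]
    (μ : Finset α → ℝ) (A0 A1 : Finset α) : Finset α → ℝ :=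
  fun B => if Disjoint B (A0 ∪ A1) then μ (A1 ∪ B) / redNorm μ A0 A1 else 0

/-- `δ_{X,e}(i) = 1 - ρ_X(e)` if `i = e`, and `ρ_{X_e}(i) - ρ_X(i)` otherwise. -/
noncomputable def deltaPP {α : Type*} [Fintype α] [DecidableEq α]
    (μ : Finset α → ℝ) (e i : α) : ℝ :=
  if i = e then 1 - intensity μ e else intensity (reduced μ ∅ {e}) i - intensity μ i

/-- A point process is `k`-homogeneous if all its samples have cardinality `k`. -/
def IsHomogeneous {α : Type*} (μ : Finset α → ℝ) (k : ℕ) : Prop :=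
  ∀ F, μ F ≠ 0 → F.card = k

/-- `ℓ∞`-independence with parameter `dinf`: for all disjoint `A0, A1` such that the
reduced process `Y = X_{A1}^{A0}` exists, and all `e` in the support of the intensity
of `Y`, the total variation `∑_{i ∈ supp ρ_Y} |δ_{Y,e}(i)|` is at most `dinf`. -/
def LinftyIndep {α : Type*} [Fintype α] [DecidableEq α]
    (μ : Finset α → ℝ) (dinf : ℝ) : Prop :=
  ∀ A0 A1 : Finset α, Disjoint A0 A1 → redNorm μ A0 A1 ≠ 0 →
    ∀ e : α, intensity (reduced μ A0 A1) e ≠ 0 →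
      ∑ i ∈ Finset.univ.filter (fun i => intensity (reduced μ A0 A1) i ≠ 0),
        |deltaPP (reduced μ A0 A1) e i| ≤ dinf

/-- The Schur complement of the entry `(e, e)` of `M`, as a matrix on the full index set. -/
noncomputable def schurCompl {α : Type*} (M : Matrix α α ℂ) (e : α) : Matrix α α ℂ :=
  Matrix.of fun i j => M i j - M i e * M e j / M e e

theorem schurCompl_apply_self_left {α : Type*} {M : Matrix α α ℂ} {e : α} (h : M e e ≠ 0) (j : α) :
    schurCompl M e e j = 0 := by
  simp [schurCompl, h]

/-- The total mass `ν` gives to the supersets of `A`. -/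
noncomputable def superMass {α : Type*} [Fintype α] [DecidableEq α]
    (ν : Finset α → ℝ) (A : Finset α) : ℝ :=
  ∑ F ∈ Finset.univ.filter (fun F => A ⊆ F), ν F

/-- `ν` is a nonnegative multiple of the law of a determinantal point process. -/
def IsDPPMultiple {α : Type*} [Fintype α] [DecidableEq α] (ν : Finset α → ℝ) : Prop :=
  (∀ F, 0 ≤ ν F) ∧ ∃ K : Matrix α α ℂ, K.PosSemidef ∧ (1 - K).PosSemidef ∧
    ∀ A, (superMass ν A : ℂ) = (superMass ν ∅ : ℂ) * (principalSub K A).det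

theorem re_mul_self_apply {α : Type*} [Fintype α] {K : Matrix α α ℂ} (hK : K.IsHermitian) (e : α) :
    ((K * K) e e).re = ∑ i, Complex.normSq (K e i) := by
  rw [mul_apply, Complex.re_sum]
  refine Finset.sum_congr rfl fun i _ => ?_
  rw [← hK.apply i e]
  simp [Complex.normSq_apply]

section

variable {α : Type*} [Fintype α] [DecidableEq α]

theorem schurCompl_posSemidef {M : Matrix α α ℂ} (hM : M.PosSemidef) {e : α} (h : M e e ≠ 0) :
    (schurCompl M e).PosSemidef := by
  set Q : Matrix α α ℂ := 1 - vecMulVec (Pi.single e 1) (fun j => M e j / M e e) with hQ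
  have h1 : M * Q = schurCompl M e := by
    ext i j
    simp [hQ, mul_sub, mul_vecMulVec, vecMulVec_apply, schurCompl, mul_div_assoc]
  have h2 : Qᴴ * schurCompl M e = schurCompl M e := by
    have hz : Pi.single e 1 ᵥ* schurCompl M e = 0 := by
      ext j
      simp [schurCompl_apply_self_left h]
    have hs : star (Pi.single e 1 : α → ℂ) = Pi.single e 1 := by
      rw [← Pi.single_star, star_one]
    rw [hQ, conjTranspose_sub, conjTranspose_one, conjTranspose_vecMulVec, sub_mul, one_mul,
      vecMulVec_mul, hs, hz]
    simp
  rw [← h2, ← h1, ← mul_assoc]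
  exact hM.conjTranspose_mul_mul_same Q

theorem one_sub_schurCompl_posSemidef {K : Matrix α α ℂ} (hK : K.PosSemidef)
    (hK1 : (1 - K).PosSemidef) (e : α) : (1 - schurCompl K e).PosSemidef := by
  have : 1 - schurCompl K e
      = (1 - K) + (K e e)⁻¹ • vecMulVec (fun i => K i e) (star fun i => K i e) := by
    ext i j
    have := hK.isHermitian.apply e j
    simp only [schurCompl, Matrix.sub_apply, Matrix.add_apply, Matrix.smul_apply, of_apply,
      vecMulVec_apply, Pi.star_apply, smul_eq_mul, this]
    ring
  rw [this]
  exact hK1.add ((posSemidef_vecMulVec_self_star _).smul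
    (inv_nonneg.mpr hK.diag_nonneg))

theorem schurCompl_sub_single_posSemidef {K : Matrix α α ℂ} (hK : K.PosSemidef)
    (hK1 : (1 - K).PosSemidef) {e : α} (h : K e e ≠ 1) :
    (schurCompl (K - Matrix.single e e 1) e).PosSemidef := by
  set P : Matrix α α ℂ := diagonal fun i => if i = e then 0 else 1 with hP
  set v : α → ℂ := fun i => if i = e then 0 else K i e with hv
  have h' : K e e - 1 ≠ 0 := sub_ne_zero.mpr h
  have h'' : 1 - K e e ≠ 0 := sub_ne_zero.mpr h.symm
  have : schurCompl (K - Matrix.single e e 1) e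
      = Pᴴ * K * P + (1 - K e e)⁻¹ • vecMulVec v (star v) := by
    ext i j
    have hj := hK.isHermitian.apply e j
    by_cases hi : i = e
    · subst hi
      rw [schurCompl_apply_self_left (by simpa using h')]
      simp [hP, hv, vecMulVec_apply]
    · by_cases hje : j = e
      · subst hje
        simp [hP, hv, vecMulVec_apply, schurCompl, h']
      · simp only [schurCompl, hP, hv, of_apply, Matrix.sub_apply, Matrix.add_apply,
          Matrix.smul_apply, vecMulVec_apply, Pi.star_apply, smul_eq_mul, hi, hje, if_false, hj,
          diagonal_conjTranspose, mul_diagonal, diagonal_mul, Matrix.single_apply, Ne.symm hi,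
          Ne.symm hje]
        simp
        grind
  rw [this]
  refine (hK.conjTranspose_mul_mul_same P).add ((posSemidef_vecMulVec_self_star v).smul ?_)
  have := hK1.diag_nonneg (i := e)
  simp only [Matrix.sub_apply, one_apply_eq] at this
  exact inv_nonneg.mpr this

theorem one_sub_schurCompl_sub_single_posSemidef {K : Matrix α α ℂ}
    (hK1 : (1 - K).PosSemidef) {e : α} (h : K e e ≠ 1) :
    (1 - schurCompl (K - Matrix.single e e 1) e).PosSemidef := by
  have h' : K e e - 1 ≠ 0 := sub_ne_zero.mpr h
  have h'' : 1 - K e e ≠ 0 := sub_ne_zero.mpr h.symm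
  have : 1 - schurCompl (K - Matrix.single e e 1) e
      = schurCompl (1 - K) e + diagonal (Pi.single e 1) := by
    ext i j
    by_cases hi : i = e
    · subst hi
      rw [Matrix.sub_apply, Matrix.add_apply, schurCompl_apply_self_left (by simpa using h'),
        schurCompl_apply_self_left (by simpa using h'')]
      simp [one_apply, diagonal_apply]
    · by_cases hje : j = e
      · subst hje
        simp [schurCompl, h', hi, neg_div, mul_div_cancel_right₀ _ h'']
      · simp [schurCompl, hi, diagonal_apply, Ne.symm hi, Ne.symm hje]
        rw [← neg_sub (K e e) 1, div_neg]
        ring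
  rw [this]
  refine (schurCompl_posSemidef hK1 (by simpa using h'')).add (PosSemidef.diagonal ?_)
  exact Pi.single_nonneg.mpr zero_le_one

theorem det_principalSub_insert (M : Matrix α α ℂ) {e : α} {A : Finset α} (he : e ∉ A) :
    (principalSub M (insert e A)).det =
      (fromBlocks (principalSub M A) (of fun i (_ : Unit) => M i e) (of fun _ j => M e j)
        (of fun _ _ => M e e)).det := by
  let f := (Finset.subtypeInsertEquivOption he).trans (Equiv.optionEquivSumPUnit.{0} _)
  rw [← det_submatrix_equiv_self f.symm]
  congr 1
  ext (i | i) (j | j) <;> rfl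

theorem det_principalSub_insert_eq_mul {M : Matrix α α ℂ} {e : α} {A : Finset α} (he : e ∉ A)
    (h : M e e ≠ 0) :
    (principalSub M (insert e A)).det = M e e * (principalSub (schurCompl M e) A).det := by
  rw [det_principalSub_insert M he]
  set D : Matrix Unit Unit ℂ := of fun _ _ => M e e with hD
  let _ : Invertible D := ⟨of fun _ _ => (M e e)⁻¹, by ext; simp [hD, mul_apply, h],
    by ext; simp [hD, mul_apply, h]⟩
  have hinv : ⅟D = of fun _ _ => (M e e)⁻¹ := rfl
  rw [det_fromBlocks₂₂, det_unique, hinv]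
  congr 1
  refine congrArg det (Matrix.ext fun i j => ?_)
  simp [principalSub, schurCompl, mul_apply]
  ring

theorem det_principalSub_insert_sub_single (K : Matrix α α ℂ) {e : α} {A : Finset α}
    (he : e ∉ A) :
    (principalSub (K - Matrix.single e e 1) (insert e A)).det =
      (principalSub K (insert e A)).det - (principalSub K A).det := by
  have hne (i : A) : e ≠ (i : α) := fun h => he (h ▸ i.2)
  rw [det_principalSub_insert _ he, det_principalSub_insert _ he, eq_sub_iff_add_eq]
  set B : Matrix A Unit ℂ := of fun i _ => K i e
  set M := fromBlocks (principalSub K A) B 0 (1 : Matrix Unit Unit ℂ) with hM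
  have hdet : (principalSub K A).det = M.det := by
    rw [hM, det_fromBlocks_zero₂₁, det_one, mul_one]
  have h1 : M = updateRow M (Sum.inr ()) (M (Sum.inr ())) := (updateRow_eq_self _ _).symm
  rw [hdet]
  conv_lhs => rw [h1]
  have h2 : fromBlocks (principalSub (K - Matrix.single e e 1) A)
      (of fun i (_ : Unit) => (K - Matrix.single e e 1 : Matrix α α ℂ) i e)
      (of fun _ j => (K - Matrix.single e e 1 : Matrix α α ℂ) e j)
      (of fun _ _ => (K - Matrix.single e e 1 : Matrix α α ℂ) e e)
      = updateRow M (Sum.inr ()) (Sum.elim (fun j => K e j) fun _ => K e e - 1) := by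
    ext (i | i) (j | j) <;> simp [hM, B, updateRow_apply, principalSub, hne]
  rw [h2, ← det_updateRow_add]
  congr 1
  ext (i | i) (j | j) <;> simp [hM, B, updateRow_apply]

theorem det_principalSub_eq_zero_of_row {M : Matrix α α ℂ} {e : α} {A : Finset α} (he : e ∈ A)
    (h : ∀ j, M e j = 0) : (principalSub M A).det = 0 :=
  det_eq_zero_of_row_eq_zero (⟨e, he⟩ : A) fun j => h j

theorem det_principalSub_singleton (M : Matrix α α ℂ) (e : α) :
    (principalSub M {e}).det = M e e := by
  rw [det_eq_elem_of_subsingleton _ (⟨e, Finset.mem_singleton_self e⟩ : ({e} : Finset α))]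
  rfl

theorem superMass_nonneg {ν : Finset α → ℝ} (hν : ∀ F, 0 ≤ ν F) (A : Finset α) :
    0 ≤ superMass ν A :=
  Finset.sum_nonneg fun F _ => hν F

theorem superMass_le {ν : Finset α → ℝ} (hν : ∀ F, 0 ≤ ν F) (A : Finset α) :
    superMass ν A ≤ superMass ν ∅ :=
  Finset.sum_le_sum_of_subset_of_nonneg (fun F _ => by simp) fun F _ _ => hν F

theorem intensity_eq_superMass (ν : Finset α → ℝ) (i : α) :
    intensity ν i = superMass ν {i} := by
  simp [intensity, superMass]

theorem superMass_condMem (ν : Finset α → ℝ) (e : α) (A : Finset α) :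
    superMass (fun B => if e ∈ B then 0 else ν (insert e B)) A =
      if e ∈ A then 0 else superMass ν (insert e A) := by
  split_ifs with he
  · refine Finset.sum_eq_zero fun F hF => if_pos ?_
    exact (Finset.mem_filter.mp hF).2 he
  · simp only [superMass]
    rw [← Finset.sum_filter_add_sum_filter_not _ (fun F => e ∈ F),
      Finset.sum_eq_zero (fun F hF => if_pos (Finset.mem_filter.mp hF).2), zero_add]
    refine Finset.sum_bij' (fun F _ => insert e F) (fun F _ => F.erase e) ?_ ?_ ?_ ?_ ?_
    · intro F hF
      simp only [Finset.mem_filter, Finset.mem_univ, true_and] at hF ⊢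
      exact Finset.insert_subset_insert e hF.1
    · intro F hF
      simp only [Finset.mem_filter, Finset.mem_univ, true_and] at hF ⊢
      exact ⟨Finset.subset_erase.mpr ⟨(Finset.subset_insert e A).trans hF, he⟩, by simp⟩
    · intro F hF
      exact Finset.erase_insert (Finset.mem_filter.mp hF).2
    · intro F hF
      exact Finset.insert_erase ((Finset.mem_filter.mp hF).2 (Finset.mem_insert_self e A))
    · intro F hF
      exact if_neg (Finset.mem_filter.mp hF).2

theorem superMass_condNotMem (ν : Finset α → ℝ) (e : α) (A : Finset α) :
    superMass (fun B => if e ∈ B then 0 else ν B) A =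
      if e ∈ A then 0 else superMass ν A - superMass ν (insert e A) := by
  split_ifs with he
  · refine Finset.sum_eq_zero fun F hF => if_pos ?_
    exact (Finset.mem_filter.mp hF).2 he
  · rw [eq_sub_iff_add_eq]
    simp only [superMass]
    rw [← Finset.sum_filter_add_sum_filter_not (Finset.univ.filter fun F => A ⊆ F)
        (fun F => e ∈ F) ν,
      ← Finset.sum_filter_add_sum_filter_not (Finset.univ.filter fun F => A ⊆ F)
        (fun F => e ∈ F) (fun F => if e ∈ F then 0 else ν F),
      Finset.sum_eq_zero (fun F hF => if_pos (Finset.mem_filter.mp hF).2), zero_add, add_comm]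
    congr 1
    · refine Finset.sum_congr ?_ fun _ _ => rfl
      ext F
      simp [Finset.insert_subset_iff, and_comm]
    · exact Finset.sum_congr rfl fun F hF => if_neg (Finset.mem_filter.mp hF).2

theorem IsDPPMultiple.of_superMass_eq_zero {ν : Finset α → ℝ} (hν : ∀ F, 0 ≤ ν F)
    (h : superMass ν ∅ = 0) : IsDPPMultiple ν := by
  refine ⟨hν, 0, PosSemidef.zero, by simpa using PosSemidef.one, fun A => ?_⟩
  have : superMass ν A = 0 := le_antisymm (h ▸ superMass_le hν A) (superMass_nonneg hν A)
  simp [h, this]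

theorem IsDPPMultiple.condMem {ν : Finset α → ℝ} (hν : IsDPPMultiple ν) (e : α) :
    IsDPPMultiple fun B => if e ∈ B then 0 else ν (insert e B) := by
  have h0 : ∀ B, 0 ≤ if e ∈ B then 0 else ν (insert e B) := fun B => by
    split_ifs
    exacts [le_rfl, hν.1 _]
  by_cases h : superMass (fun B => if e ∈ B then 0 else ν (insert e B)) ∅ = 0
  · exact .of_superMass_eq_zero h0 h
  obtain ⟨-, K, hK, hK1, hdet⟩ := hν
  simp only [superMass_condMem, Finset.notMem_empty, if_false, insert_empty_eq] at h
  have he := hdet {e}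
  rw [det_principalSub_singleton] at he
  have hKe : K e e ≠ 0 := fun h' => h (by simpa [h'] using he)
  refine ⟨h0, schurCompl K e, schurCompl_posSemidef hK hKe,
    one_sub_schurCompl_posSemidef hK hK1 e, fun A => ?_⟩
  simp only [superMass_condMem, Finset.notMem_empty, if_false, insert_empty_eq]
  split_ifs with heA
  · simp [det_principalSub_eq_zero_of_row heA (schurCompl_apply_self_left hKe)]
  · rw [he, hdet, det_principalSub_insert_eq_mul heA hKe, mul_assoc]

theorem IsDPPMultiple.condNotMem {ν : Finset α → ℝ} (hν : IsDPPMultiple ν) (e : α) :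
    IsDPPMultiple fun B => if e ∈ B then 0 else ν B := by
  have h0 : ∀ B, 0 ≤ if e ∈ B then 0 else ν B := fun B => by
    split_ifs
    exacts [le_rfl, hν.1 _]
  by_cases h : superMass (fun B => if e ∈ B then 0 else ν B) ∅ = 0
  · exact .of_superMass_eq_zero h0 h
  obtain ⟨-, K, hK, hK1, hdet⟩ := hν
  simp only [superMass_condNotMem, Finset.notMem_empty, if_false, insert_empty_eq] at h
  have he := hdet {e}
  rw [det_principalSub_singleton] at he
  have hKe : K e e ≠ 1 := fun h' => h (by
    rw [h', mul_one] at he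
    rw [sub_eq_zero]
    exact_mod_cast he.symm)
  have hKe' : (K - Matrix.single e e 1 : Matrix α α ℂ) e e ≠ 0 := by simpa [sub_eq_zero] using hKe
  refine ⟨h0, schurCompl (K - Matrix.single e e 1) e, schurCompl_sub_single_posSemidef hK hK1 hKe,
    one_sub_schurCompl_sub_single_posSemidef hK1 hKe, fun A => ?_⟩
  simp only [superMass_condNotMem, Finset.notMem_empty, if_false, insert_empty_eq]
  split_ifs with heA
  · simp [det_principalSub_eq_zero_of_row heA (schurCompl_apply_self_left hKe')]
  · have h1 := det_principalSub_insert_eq_mul heA hKe'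
    rw [det_principalSub_insert_sub_single K heA] at h1
    simp only [Matrix.sub_apply, single_apply_same] at h1
    push_cast
    rw [he, hdet A, hdet (insert e A)]
    linear_combination (-(superMass ν ∅ : ℂ)) * h1

theorem IsDPPMultiple.restrict {ν : Finset α → ℝ} (hν : IsDPPMultiple ν) (A0 A1 : Finset α)
    (hA : Disjoint A0 A1) :
    IsDPPMultiple fun B => if Disjoint B (A0 ∪ A1) then ν (A1 ∪ B) else 0 := by
  induction A0 using Finset.induction_on with
  | empty =>
    induction A1 using Finset.induction_on with
    | empty => simpa using hν
    | insert e s he ih =>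
      convert (ih (Finset.disjoint_empty_left _)).condMem e using 2 with B
      by_cases hB : e ∈ B
      · simp [hB]
      · simp [hB, he, Finset.disjoint_insert_left, Finset.disjoint_insert_right,
          Finset.insert_union]
  | insert e s he ih =>
    rw [Finset.disjoint_insert_left] at hA
    convert (ih hA.2).condNotMem e using 2 with B
    by_cases hB : e ∈ B
    · simp [hB, Finset.insert_union]
    · simp [hB, Finset.insert_union, Finset.disjoint_insert_right]

theorem redNorm_eq_superMass (μ : Finset α → ℝ) (A0 A1 : Finset α) :
    redNorm μ A0 A1 =
      superMass (fun B => if Disjoint B (A0 ∪ A1) then μ (A1 ∪ B) else 0) ∅ := by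
  simp [redNorm, superMass, Finset.sum_filter]

theorem superMass_reduced (μ : Finset α → ℝ) (A0 A1 A : Finset α) :
    superMass (reduced μ A0 A1) A =
      superMass (fun B => if Disjoint B (A0 ∪ A1) then μ (A1 ∪ B) else 0) A
        / redNorm μ A0 A1 := by
  rw [superMass, superMass, Finset.sum_div]
  refine Finset.sum_congr rfl fun F _ => ?_
  simp only [reduced]
  split_ifs <;> simp

theorem IsDPPMultiple.exists_isDPP_reduced {μ : Finset α → ℝ} (hμ : IsDPPMultiple μ)
    {A0 A1 : Finset α} (hA : Disjoint A0 A1) (h : redNorm μ A0 A1 ≠ 0) :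
    ∃ K : Matrix α α ℂ, K.PosSemidef ∧ (1 - K).PosSemidef ∧ IsDPP (reduced μ A0 A1) K := by
  obtain ⟨-, K, hK, hK1, hdet⟩ := hμ.restrict A0 A1 hA
  refine ⟨K, hK, hK1, fun A => ?_⟩
  change ((superMass (reduced μ A0 A1) A : ℝ) : ℂ) = _
  rw [superMass_reduced, Complex.ofReal_div, hdet, ← redNorm_eq_superMass,
    mul_div_cancel_left₀ _ (by exact_mod_cast h)]

theorem IsDPP.intensity_eq {μ : Finset α → ℝ} {K : Matrix α α ℂ} (h : IsDPP μ K) (i : α) :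
    (intensity μ i : ℂ) = K i i := by
  rw [intensity_eq_superMass, ← det_principalSub_singleton K i]
  exact h {i}

theorem intensity_reduced_singleton (μ : Finset α → ℝ) {e i : α} (hi : i ≠ e) :
    intensity (reduced μ ∅ {e}) i = superMass μ {e, i} / intensity μ e := by
  have h : (fun B => if Disjoint B (∅ ∪ {e}) then μ ({e} ∪ B) else 0)
      = fun B => if e ∈ B then 0 else μ (insert e B) := by
    ext B
    by_cases hB : e ∈ B <;> simp [hB]
  rw [intensity_eq_superMass, superMass_reduced, redNorm_eq_superMass, h, superMass_condMem,
    superMass_condMem, intensity_eq_superMass]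
  simp [Ne.symm hi]

theorem IsDPP.deltaPP_of_ne {μ : Finset α → ℝ} {K : Matrix α α ℂ} (hK : K.IsHermitian)
    (h : IsDPP μ K) {e i : α} (he : K e e ≠ 0) (hi : i ≠ e) :
    deltaPP μ e i = -(Complex.normSq (K e i) / (K e e).re) := by
  have hre : (K e e : ℂ) = ((K e e).re : ℂ) := by
    rw [← h.intensity_eq, Complex.ofReal_re]
  have h2 := h {e, i}
  change ((superMass μ {e, i} : ℝ) : ℂ) = _ at h2
  rw [det_principalSub_insert_eq_mul (by simpa using hi.symm) he, det_principalSub_singleton] at h2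
  have hc : K i e * K e i = (Complex.normSq (K e i) : ℂ) := by
    rw [← hK.apply i e, mul_comm]
    exact Complex.mul_conj _
  rw [deltaPP, if_neg hi, intensity_reduced_singleton μ hi]
  rw [← Complex.ofReal_inj]
  push_cast
  rw [h2, h.intensity_eq, h.intensity_eq, ← hc, ← hre]
  simp only [schurCompl, of_apply]
  field_simp
  ring

theorem posSemidef_sub_mul_self {K : Matrix α α ℂ} (hK : K.PosSemidef)
    (hK1 : (1 - K).PosSemidef) : (K - K * K).PosSemidef := by
  have h := (hK1.conjTranspose_mul_mul_same K).add (hK.conjTranspose_mul_mul_same (1 - K))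
  rw [hK.isHermitian.eq, hK1.isHermitian.eq] at h
  convert h using 1
  noncomm_ring

theorem apply_eq_zero_of_diag_eq_zero {K : Matrix α α ℂ} (hK : K.PosSemidef)
    (hK1 : (1 - K).PosSemidef) {i : α} (hi : K i i = 0) (e : α) : K e i = 0 := by
  have h := (Complex.nonneg_iff.mp ((posSemidef_sub_mul_self hK hK1).diag_nonneg (i := i))).1
  rw [Matrix.sub_apply, hi, Complex.sub_re, re_mul_self_apply hK.isHermitian] at h
  have h' : ∑ j, Complex.normSq (K i j) = 0 :=
    le_antisymm (by simpa using h) (Finset.sum_nonneg fun _ _ => Complex.normSq_nonneg _)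
  rw [Finset.sum_eq_zero_iff_of_nonneg fun _ _ => Complex.normSq_nonneg _] at h'
  rw [← hK.isHermitian.apply, Complex.normSq_eq_zero.mp (h' e (Finset.mem_univ e)), star_zero]

theorem IsDPP.sum_abs_deltaPP {μ : Finset α → ℝ} {K : Matrix α α ℂ} (hK : K.PosSemidef)
    (hK1 : (1 - K).PosSemidef) (h : IsDPP μ K) {e : α} (he : 0 < (K e e).re) :
    ∑ i ∈ Finset.univ.filter (fun i => intensity μ i ≠ 0), |deltaPP μ e i|
      = (1 - (K e e).re) + (((K * K) e e).re - (K e e).re ^ 2) / (K e e).re := by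
  have hint (i : α) : intensity μ i = (K i i).re := by
    rw [← h.intensity_eq, Complex.ofReal_re]
  have him : (K e e).im = 0 := by rw [← h.intensity_eq, Complex.ofReal_im]
  have hne : K e e ≠ 0 := fun h' => by simp [h'] at he
  have hle : (K e e).re ≤ 1 := by
    have := (Complex.nonneg_iff.mp (hK1.diag_nonneg (i := e))).1
    simpa using this
  have hdelta (i : α) (hi : i ≠ e) :
      |deltaPP μ e i| = Complex.normSq (K e i) / (K e e).re := by
    rw [h.deltaPP_of_ne hK.isHermitian hne hi, abs_neg,
      abs_of_nonneg (div_nonneg (Complex.normSq_nonneg _) he.le)]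
  have hzero (i : α) (hi : i ∈ Finset.univ) (hn : |deltaPP μ e i| ≠ 0) : intensity μ i ≠ 0 := by
    intro h0
    have h1 : K i i = 0 := by rw [← h.intensity_eq, h0, Complex.ofReal_zero]
    have h2 : i ≠ e := by
      rintro rfl
      exact hne h1
    apply hn
    rw [hdelta i h2, apply_eq_zero_of_diag_eq_zero hK hK1 h1 e]
    simp
  rw [Finset.sum_filter_of_ne hzero, ← Finset.add_sum_erase _ _ (Finset.mem_univ e),
    Finset.sum_congr rfl fun i hi => hdelta i (Finset.ne_of_mem_erase hi), ← Finset.sum_div,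
    re_mul_self_apply hK.isHermitian, ← Finset.add_sum_erase _ _ (Finset.mem_univ e), deltaPP,
    if_pos rfl, hint, abs_of_nonneg (by linarith), Complex.normSq_apply, him]
  ring

theorem IsDPP.sum_abs_deltaPP_le {μ : Finset α → ℝ} {K : Matrix α α ℂ} (hK : K.PosSemidef)
    (hK1 : (1 - K).PosSemidef) (h : IsDPP μ K) {e : α} (he : 0 < (K e e).re) :
    ∑ i ∈ Finset.univ.filter (fun i => intensity μ i ≠ 0), |deltaPP μ e i|
      ≤ 2 - 2 * (K e e).re := by
  have hsq : ((K * K) e e).re ≤ (K e e).re := by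
    have := (Complex.nonneg_iff.mp ((posSemidef_sub_mul_self hK hK1).diag_nonneg (i := e))).1
    simpa using this
  have hdiv : (((K * K) e e).re - (K e e).re ^ 2) / (K e e).re ≤ 1 - (K e e).re := by
    rw [div_le_iff₀ he]
    nlinarith
  rw [h.sum_abs_deltaPP hK hK1 he]
  linarith

end

/-- **DPPs are ℓ∞-independent with parameter 2.** -/
theorem dpp_linfty_indep_two
    {m : ℕ} (K : Matrix (Fin m) (Fin m) ℂ) (hKh : K.IsHermitian)
    (hK0 : K.PosSemidef) (hK1 : ((1 : Matrix (Fin m) (Fin m) ℂ) - K).PosSemidef)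
    (μ : Finset (Fin m) → ℝ) (hμ0 : ∀ F, 0 ≤ μ F) (hμ1 : ∑ F, μ F = 1)
    (hdpp : IsDPP μ K) :
    LinftyIndep μ 2 ∧
    ∀ e : Fin m, 0 < (K e e).re →
      (∑ i ∈ Finset.univ.filter (fun i => intensity μ i ≠ 0), |deltaPP μ e i|
          = (1 - (K e e).re) + (((K * K) e e).re - (K e e).re ^ 2) / (K e e).re) ∧
      (∑ i ∈ Finset.univ.filter (fun i => intensity μ i ≠ 0), |deltaPP μ e i|
          ≤ 2 - 2 * (K e e).re) := by
  have hmul : IsDPPMultiple μ := by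
    refine ⟨hμ0, K, hK0, hK1, fun A => ?_⟩
    have h1 : superMass μ ∅ = 1 := by simpa [superMass] using hμ1
    rw [h1, Complex.ofReal_one, one_mul]
    exact hdpp A
  refine ⟨fun A0 A1 hA hnorm e he => ?_, fun e he =>
    ⟨hdpp.sum_abs_deltaPP hK0 hK1 he, hdpp.sum_abs_deltaPP_le hK0 hK1 he⟩⟩
  obtain ⟨L, hL, hL1, hdppL⟩ := hmul.exists_isDPP_reduced hA hnorm
  have hint : intensity (reduced μ A0 A1) e = (L e e).re := by
    rw [← hdppL.intensity_eq, Complex.ofReal_re]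
  have hpos : 0 < (L e e).re :=
    lt_of_le_of_ne (Complex.nonneg_iff.mp hL.diag_nonneg).1 (hint ▸ he.symm)
  linarith [hdppL.sum_abs_deltaPP_le hL hL1 hpos]
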